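/- arXiv:2110.02787 — 4 statements merged into one kernel-verified Lean document; each statement's English description precedes it below -/
import Mathlib

section
/- Let μ be the Lebesgue measure on ℝ^d. Let q : ℝ^d → ℝ be a probability density (q ≥ 0, ∫ q dμ = 1) and u : ℝ^d → ℝ an unnormalized density (u ≥ 0, 0 < ∫ u dμ < ∞), with q(x) > 0 and u(x) > 0 for μ-a.e. x. For a measurable function D : ℝ^d → ℝ define the logarithmic Bregman score 𝔅(D) = ∫ q(x) exp(D(x)) dμ(x) − ∫ u(x) D(x) dμ(x) (valued in ℝ ∪ {+∞}). Then for every measurable D with ∫ u(x) |D(x)| dμ(x) < ∞, one has 𝔅(D) ≥ 𝔅(D*) where D*(x) = log(u(x)/q(x)), and equality holds if and only if D(x) = D*(x) for μ-a.e. x. -/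
open MeasureTheory
open scoped ENNReal

/-- The logarithmic Bregman score `𝔅(D) = ∫ q e^D dμ − ∫ u D dμ`, valued in the extended
reals.  It is realized as the upper integral of the positive part of the integrand
`q e^D − u D` minus the upper integral of its negative part; whenever
`∫ u |D| dμ < ∞` this agrees with `∫ q e^D dμ − ∫ u D dμ` as an element of `ℝ ∪ {+∞}`. -/
noncomputable def logBregman {d : ℕ} (q u D : (Fin d → ℝ) → ℝ) : EReal :=
  ((∫⁻ x, ENNReal.ofReal (q x * Real.exp (D x) - u x * D x) ∂volume : ℝ≥0∞) : EReal)
    - ((∫⁻ x, ENNReal.ofReal (u x * D x - q x * Real.exp (D x)) ∂volume : ℝ≥0∞) : EReal)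

theorem EReal.eq_and_eq_of_coe_sub_eq {a b c e : ℝ≥0∞} (hc : c ≠ ⊤) (hb : b ≠ ⊤)
    (hca : c ≤ a) (hbe : b ≤ e) (h : (a : EReal) - b = (c : EReal) - e) : a = c ∧ b = e := by
  lift b to NNReal using hb
  lift c to NNReal using hc
  induction a using ENNReal.recTopCoe with
  | top =>
    induction e using ENNReal.recTopCoe with
    | top => simp [EReal.coe_nnreal_eq_coe_real] at h
    | coe e =>
      simp only [EReal.coe_nnreal_eq_coe_real, ← EReal.coe_sub,
        EReal.coe_ennreal_top, EReal.top_sub_coe] at h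
      exact absurd h.symm (EReal.coe_ne_top _)
  | coe a =>
    induction e using ENNReal.recTopCoe with
    | top =>
      simp only [EReal.coe_nnreal_eq_coe_real, ← EReal.coe_sub,
        EReal.coe_ennreal_top, EReal.sub_top] at h
      exact absurd h (EReal.coe_ne_bot _)
    | coe e =>
      have h' : (a : ℝ) - b = c - e := by
        simp only [EReal.coe_nnreal_eq_coe_real] at h
        exact_mod_cast h
      norm_cast at hca hbe ⊢
      have h1 : (c : ℝ) ≤ a := hca
      have h2 : (b : ℝ) ≤ e := hbe
      exact ⟨NNReal.eq (by linarith), NNReal.eq (by linarith)⟩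

theorem MeasureTheory.ae_eq_of_ae_le_of_lintegral_parts_sub_eq {α : Type*} [MeasurableSpace α]
    {μ : Measure α} {f g : α → ℝ} (hf : Measurable f) (hg : Measurable g) (hgf : g ≤ᵐ[μ] f)
    (hgpos : ∫⁻ x, ENNReal.ofReal (g x) ∂μ ≠ ⊤) (hfneg : ∫⁻ x, ENNReal.ofReal (-f x) ∂μ ≠ ⊤)
    (h : ((∫⁻ x, ENNReal.ofReal (f x) ∂μ : ℝ≥0∞) : EReal)
        - ((∫⁻ x, ENNReal.ofReal (-f x) ∂μ : ℝ≥0∞) : EReal)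
      = ((∫⁻ x, ENNReal.ofReal (g x) ∂μ : ℝ≥0∞) : EReal)
        - ((∫⁻ x, ENNReal.ofReal (-g x) ∂μ : ℝ≥0∞) : EReal)) :
    f =ᵐ[μ] g := by
  have hpos : (fun x => ENNReal.ofReal (g x)) ≤ᵐ[μ] fun x => ENNReal.ofReal (f x) := by
    filter_upwards [hgf] with x hx using ENNReal.ofReal_le_ofReal hx
  have hneg : (fun x => ENNReal.ofReal (-f x)) ≤ᵐ[μ] fun x => ENNReal.ofReal (-g x) := by
    filter_upwards [hgf] with x hx using ENNReal.ofReal_le_ofReal (neg_le_neg hx)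
  obtain ⟨h1, h2⟩ := EReal.eq_and_eq_of_coe_sub_eq hgpos hfneg (lintegral_mono_ae hpos)
    (lintegral_mono_ae hneg) h
  filter_upwards [hgf,
    ae_eq_of_ae_le_of_lintegral_le hpos hgpos hf.ennreal_ofReal.aemeasurable h1.le,
    ae_eq_of_ae_le_of_lintegral_le hneg hfneg hg.neg.ennreal_ofReal.aemeasurable h2.ge]
    with x hx hp hn
  refine le_antisymm ?_ hx
  rcases le_or_gt (f x) 0 with h0 | h0
  · have := (ENNReal.ofReal_le_ofReal_iff (neg_nonneg.2 h0)).1 hn.ge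
    linarith
  · by_contra! hlt
    exact absurd hp ((ENNReal.ofReal_lt_ofReal_iff h0).2 hlt).ne

theorem mul_exp_sub_mul_eq {q u : ℝ} (hq : 0 < q) (hu : 0 < u) (t : ℝ) :
    q * Real.exp t - u * t = u - u * Real.log (u / q) +
      u * (Real.exp (t - Real.log (u / q)) - (t - Real.log (u / q) + 1)) := by
  rw [Real.exp_sub, Real.exp_log (div_pos hu hq)]
  field_simp
  ring

theorem sub_mul_log_div_le {q u : ℝ} (hq : 0 < q) (hu : 0 < u) (t : ℝ) :
    u - u * Real.log (u / q) ≤ q * Real.exp t - u * t := by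
  rw [mul_exp_sub_mul_eq hq hu]
  have := mul_nonneg hu.le (sub_nonneg.2 (Real.add_one_le_exp (t - Real.log (u / q))))
  linarith

theorem eq_log_div_of_mul_exp_sub_mul_eq {q u t : ℝ} (hq : 0 < q) (hu : 0 < u)
    (h : q * Real.exp t - u * t = u - u * Real.log (u / q)) : t = Real.log (u / q) := by
  by_contra hne
  rw [mul_exp_sub_mul_eq hq hu] at h
  have := mul_pos hu (sub_pos.2 (Real.add_one_lt_exp (sub_ne_zero.2 hne)))
  linarith

theorem mul_exp_log_div_sub {q u : ℝ} (hq : 0 < q) (hu : 0 < u) :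
    q * Real.exp (Real.log (u / q)) - u * Real.log (u / q) = u - u * Real.log (u / q) := by
  simp [mul_exp_sub_mul_eq hq hu]

/-- **Theorem 1** (log-scale Bregman score characterization of the log density ratio).
If `q` is a probability density on `ℝ^d`, `u` is an unnormalized density
(`0 < ∫ u < ∞`), both a.e. positive, then for every measurable `D` with
`∫ u |D| dμ < ∞` one has `𝔅(D) ≥ 𝔅(D*)` for `D* = log (u/q)`, with equality iff
`D = D*` almost everywhere. -/
theorem logBregman_ge_of_logRatio
    (d : ℕ) (q u : (Fin d → ℝ) → ℝ)
    (hqm : Measurable q) (hum : Measurable u)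
    (hq0 : ∀ x, 0 ≤ q x) (hq1 : ∫ x, q x ∂volume = 1)
    (hu0 : ∀ x, 0 ≤ u x)
    (huI : Integrable u volume) (huZ : 0 < ∫ x, u x ∂volume)
    (hqpos : ∀ᵐ x ∂(volume : Measure (Fin d → ℝ)), 0 < q x)
    (hupos : ∀ᵐ x ∂(volume : Measure (Fin d → ℝ)), 0 < u x)
    (D : (Fin d → ℝ) → ℝ) (hDm : Measurable D)
    (hDint : ∫⁻ x, ENNReal.ofReal (u x * |D x|) ∂volume < ⊤) :
    logBregman q u D ≥ logBregman q u (fun x => Real.log (u x / q x)) ∧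
      (logBregman q u D = logBregman q u (fun x => Real.log (u x / q x)) ↔
        D =ᵐ[volume] fun x => Real.log (u x / q x)) := by
  set L : (Fin d → ℝ) → ℝ := fun x => Real.log (u x / q x)
  have hLm : Measurable L := (hum.div hqm).log
  have hle : (fun x => q x * Real.exp (L x) - u x * L x) ≤ᵐ[volume]
      fun x => q x * Real.exp (D x) - u x * D x := by
    filter_upwards [hqpos, hupos] with x hq hu
    exact (mul_exp_log_div_sub hq hu).trans_le (sub_mul_log_div_le hq hu (D x))
  refine ⟨?_, fun h => ?_, fun h => ?_⟩
  · refine EReal.sub_le_sub (EReal.coe_ennreal_le_coe_ennreal_iff.2 (lintegral_mono_ae ?_))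
      (EReal.coe_ennreal_le_coe_ennreal_iff.2 (lintegral_mono_ae ?_))
    · filter_upwards [hle] with x hx using ENNReal.ofReal_le_ofReal hx
    · filter_upwards [hle] with x hx using ENNReal.ofReal_le_ofReal (by linarith)
  · have hqI : Integrable q volume := .of_integral_ne_zero (by simp [hq1])
    have hpos : ∫⁻ x, ENNReal.ofReal (q x * Real.exp (L x) - u x * L x) ≠ ⊤ := by
      refine ((lintegral_mono_ae ?_).trans_lt hqI.lintegral_lt_top).ne
      filter_upwards [hqpos, hupos] with x hq hu
      refine ENNReal.ofReal_le_ofReal ((mul_exp_log_div_sub hq hu).trans_le ?_)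
      simpa using sub_mul_log_div_le hq hu 0
    have hneg : ∫⁻ x, ENNReal.ofReal (-(q x * Real.exp (D x) - u x * D x)) ≠ ⊤ := by
      refine ((lintegral_mono fun x => ENNReal.ofReal_le_ofReal ?_).trans_lt hDint).ne
      have h1 := mul_nonneg (hq0 x) (Real.exp_pos (D x)).le
      have h2 := mul_le_mul_of_nonneg_left (le_abs_self (D x)) (hu0 x)
      linarith
    have heq := ae_eq_of_ae_le_of_lintegral_parts_sub_eq
      ((hqm.mul hDm.exp).sub (hum.mul hDm)) ((hqm.mul hLm.exp).sub (hum.mul hLm)) hle hpos hneg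
      (by simpa only [logBregman, Pi.sub_apply, Pi.mul_apply, neg_sub] using h)
    filter_upwards [heq, hqpos, hupos] with x hx hq hu
    exact eq_log_div_of_mul_exp_sub_mul_eq hq hu (hx.trans (mul_exp_log_div_sub hq hu))
  · unfold logBregman
    congr 2 <;>
    · refine lintegral_congr_ae ?_
      filter_upwards [h] with x hx
      rw [hx]
end

section
/- Let μ be the Lebesgue measure on ℝ^d. Let q : ℝ^d → ℝ be a probability density (q ≥ 0, ∫ q dμ = 1) and u : ℝ^d → ℝ an unnormalized density (u ≥ 0, 0 < ∫ u dμ < ∞), with q(x) > 0 and u(x) > 0 for μ-a.e. x, and assume ∫ u(x) |log(u(x)/q(x))| dμ(x) < ∞. Then the function D*(x) = log(u(x)/q(x)) attains the minimum of the functional 𝔅(D) = ∫ q(x) exp(D(x)) dμ(x) − ∫ u(x) D(x) dμ(x) over all measurable functions D : ℝ^d → ℝ with ∫ u |D| dμ < ∞; that is, 𝔅(D*) ≤ 𝔅(D) for every such D. -/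
open MeasureTheory
open scoped ENNReal

/-- Pointwise minimality: `t ↦ b e^t − a t` is minimized at `t = log (a / b)`. -/
theorem mul_exp_log_div_sub_le {a b : ℝ} (ha : 0 < a) (hb : 0 < b) (t : ℝ) :
    b * Real.exp (Real.log (a / b)) - a * Real.log (a / b) ≤ b * Real.exp t - a * t := by
  have hexp : b * Real.exp t = a * Real.exp (t - Real.log (a / b)) := by
    rw [Real.exp_sub, Real.exp_log (div_pos ha hb)]
    field_simp
  have hlog : b * Real.exp (Real.log (a / b)) = a := by
    rw [Real.exp_log (div_pos ha hb)]
    field_simp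
  have h := mul_le_mul_of_nonneg_left (Real.add_one_le_exp (t - Real.log (a / b))) ha.le
  rw [hexp, hlog]
  linarith

/-- The log density ratio `D* = log (u/q)` attains the minimum of the logarithmic Bregman
score `𝔅(D) = ∫ q e^D dμ − ∫ u D dμ` over all measurable `D : ℝ^d → ℝ` with
`∫ u |D| dμ < ∞`, provided `q` is a probability density, `u` an unnormalized density
(`0 < ∫ u < ∞`), both a.e. positive, and `∫ u |log (u/q)| dμ < ∞`. -/
theorem logRatio_mem_argmin_logBregman
    (d : ℕ) (q u : (Fin d → ℝ) → ℝ)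
    (hqm : Measurable q) (hum : Measurable u)
    (hq0 : ∀ x, 0 ≤ q x) (hq1 : ∫ x, q x ∂volume = 1)
    (hu0 : ∀ x, 0 ≤ u x)
    (huI : Integrable u volume) (huZ : 0 < ∫ x, u x ∂volume)
    (hqpos : ∀ᵐ x ∂(volume : Measure (Fin d → ℝ)), 0 < q x)
    (hupos : ∀ᵐ x ∂(volume : Measure (Fin d → ℝ)), 0 < u x)
    (hstar : ∫⁻ x, ENNReal.ofReal (u x * |Real.log (u x / q x)|) ∂volume < ⊤) :
    ∀ D : (Fin d → ℝ) → ℝ, Measurable D →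
      (∫⁻ x, ENNReal.ofReal (u x * |D x|) ∂volume < ⊤) →
      logBregman q u (fun x => Real.log (u x / q x)) ≤ logBregman q u D := by
  intro D _ _
  have hle : ∀ᵐ x ∂(volume : Measure (Fin d → ℝ)),
      q x * Real.exp (Real.log (u x / q x)) - u x * Real.log (u x / q x) ≤
        q x * Real.exp (D x) - u x * D x := by
    filter_upwards [hqpos, hupos] with x hq hu
    exact mul_exp_log_div_sub_le hu hq (D x)
  refine EReal.sub_le_sub ?_ ?_
  · refine EReal.coe_ennreal_le_coe_ennreal_iff.2 (lintegral_mono_ae ?_)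
    filter_upwards [hle] with x hx
    exact ENNReal.ofReal_le_ofReal hx
  · refine EReal.coe_ennreal_le_coe_ennreal_iff.2 (lintegral_mono_ae ?_)
    filter_upwards [hle] with x hx
    exact ENNReal.ofReal_le_ofReal (by linarith)
end

section
/- Let μ be the Lebesgue measure on ℝ^d, let g : (0,∞) → ℝ be differentiable and strictly convex, let q : ℝ^d → ℝ be a probability density (q ≥ 0, ∫ q dμ = 1) and u : ℝ^d → ℝ an unnormalized density (u ≥ 0, 0 < ∫ u dμ < ∞), with q(x) > 0 and u(x) > 0 for μ-a.e. x. For a measurable function R : ℝ^d → (0,∞) define the Bregman score 𝔅_g(R) = ∫ q(x)·[g'(R(x))·R(x) − g(R(x))] dμ(x) − ∫ u(x)·g'(R(x)) dμ(x). Let R*(x) = u(x)/q(x). Then for every measurable R : ℝ^d → (0,∞) for which the integrals defining 𝔅_g(R) and 𝔅_g(R*) are finite, one has 𝔅_g(R) ≥ 𝔅_g(R*), and equality holds if and only if R(x) = R*(x) for μ-a.e. x. -/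
open MeasureTheory

theorem StrictConvexOn.add_mul_sub_lt_of_hasDerivAt {S : Set ℝ} {f : ℝ → ℝ} {f' x y : ℝ}
    (hf : StrictConvexOn ℝ S f) (hx : x ∈ S) (hy : y ∈ S) (hxy : x ≠ y)
    (hd : HasDerivAt f f' x) : f x + f' * (y - x) < f y := by
  rcases lt_or_gt_of_ne hxy with h | h
  · have := hf.lt_slope_of_hasDerivAt hx hy h hd
    rw [slope_def_field, lt_div_iff₀ (sub_pos.2 h)] at this
    linarith
  · have := hf.slope_lt_of_hasDerivAt hy hx h hd
    rw [slope_def_field, div_lt_iff₀ (sub_pos.2 h)] at this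
    linarith

/-- **Bregman-score characterization of the density ratio.**  Let `g` be differentiable
and strictly convex on `(0, ∞)` with derivative `g'`, let `q` be a probability density
on `ℝ^d` and `u` an unnormalized density (`0 < ∫ u < ∞`), both a.e. positive.  For a
measurable positive `R`, the Bregman score is
`𝔅_g(R) = ∫ q (g'(R) R − g(R)) dμ − ∫ u g'(R) dμ`.  Then for every measurable positive
`R` for which the integrals defining `𝔅_g(R)` and `𝔅_g(R*)` (with `R* = u/q`) are
finite, one has `𝔅_g(R) ≥ 𝔅_g(R*)`, with equality iff `R = R*` a.e. -/
theorem bregman_score_ge_of_ratio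
    (d : ℕ) (g g' : ℝ → ℝ)
    (hderiv : ∀ x ∈ Set.Ioi (0 : ℝ), HasDerivAt g (g' x) x)
    (hconv : StrictConvexOn ℝ (Set.Ioi (0 : ℝ)) g)
    (q u : (Fin d → ℝ) → ℝ)
    (hqm : Measurable q) (hum : Measurable u)
    (hq0 : ∀ x, 0 ≤ q x) (hq1 : ∫ x, q x ∂volume = 1)
    (hu0 : ∀ x, 0 ≤ u x)
    (huI : Integrable u volume) (huZ : 0 < ∫ x, u x ∂volume)
    (hqpos : ∀ᵐ x ∂(volume : Measure (Fin d → ℝ)), 0 < q x)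
    (hupos : ∀ᵐ x ∂(volume : Measure (Fin d → ℝ)), 0 < u x)
    (R : (Fin d → ℝ) → ℝ) (hRm : Measurable R) (hRpos : ∀ x, 0 < R x)
    (hI1 : Integrable (fun x => q x * (g' (R x) * R x - g (R x))) volume)
    (hI2 : Integrable (fun x => u x * g' (R x)) volume)
    (hI3 : Integrable
      (fun x => q x * (g' (u x / q x) * (u x / q x) - g (u x / q x))) volume)
    (hI4 : Integrable (fun x => u x * g' (u x / q x)) volume) :
    (∫ x, q x * (g' (u x / q x) * (u x / q x) - g (u x / q x)) ∂volume)
          - ∫ x, u x * g' (u x / q x) ∂volume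
        ≤ (∫ x, q x * (g' (R x) * R x - g (R x)) ∂volume)
          - ∫ x, u x * g' (R x) ∂volume ∧
      ((∫ x, q x * (g' (R x) * R x - g (R x)) ∂volume)
            - ∫ x, u x * g' (R x) ∂volume
          = (∫ x, q x * (g' (u x / q x) * (u x / q x) - g (u x / q x)) ∂volume)
            - ∫ x, u x * g' (u x / q x) ∂volume ↔
        R =ᵐ[volume] fun x => u x / q x) := by
  set A := fun x => q x * (g' (R x) * R x - g (R x)) - u x * g' (R x) with hA
  set B := fun x => q x * (g' (u x / q x) * (u x / q x) - g (u x / q x))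
    - u x * g' (u x / q x) with hB
  have hAI : Integrable A volume := hI1.sub hI2
  have hBI : Integrable B volume := hI3.sub hI4
  rw [← integral_sub hI1 hI2, ← integral_sub hI3 hI4]
  change ∫ x, B x ≤ ∫ x, A x ∧ (∫ x, A x = ∫ x, B x ↔ _)
  have hgap : ∀ᵐ x ∂(volume : Measure (Fin d → ℝ)),
      B x ≤ A x ∧ (A x = B x ↔ R x = u x / q x) := by
    filter_upwards [hqpos, hupos] with x hq hu
    have hdiff : A x - B x = q x *
        (g (u x / q x) - (g (R x) + g' (R x) * (u x / q x - R x))) := by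
      simp only [hA, hB]
      field_simp
      ring
    by_cases hR : R x = u x / q x
    · have : A x = B x := by simp only [hA, hB, hR]
      exact ⟨this.ge, iff_of_true this hR⟩
    · have hpos : 0 < A x - B x := hdiff ▸ mul_pos hq (sub_pos.2
        (hconv.add_mul_sub_lt_of_hasDerivAt (hRpos x) (div_pos hu hq) hR
          (hderiv _ (hRpos x))))
      exact ⟨(sub_pos.1 hpos).le, iff_of_false (sub_pos.1 hpos).ne' hR⟩
  have hle : B ≤ᵐ[volume] A := hgap.mono fun _ h => h.1
  refine ⟨integral_mono_ae hBI hAI hle, ?_⟩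
  rw [eq_comm, integral_eq_iff_of_ae_le hBI hAI hle]
  exact Filter.eventually_congr (hgap.mono fun _ h => eq_comm.trans h.2)
end

section
/- Let μ be the Lebesgue measure on ℝ^d, let q : ℝ^d → ℝ be a probability density (q ≥ 0, ∫ q dμ = 1) and u : ℝ^d → ℝ an unnormalized density (u ≥ 0, 0 < ∫ u dμ < ∞), with q(x) > 0 and u(x) > 0 for μ-a.e. x. For a measurable function R : ℝ^d → (0,∞) define 𝔅(R) = ∫ q(x)·R(x) dμ(x) − ∫ u(x)·log(R(x)) dμ(x) (this is the Bregman score with generator g(x) = x·log x − x). Let R*(x) = u(x)/q(x). Then for every measurable R : ℝ^d → (0,∞) with ∫ u |log R| dμ < ∞, one has 𝔅(R) ≥ 𝔅(R*) = ∫ u dμ − ∫ u(x)·log(u(x)/q(x)) dμ(x), and equality holds if and only if R(x) = R*(x) for μ-a.e. x. -/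
open MeasureTheory
open scoped ENNReal

/-- The Bregman score with generator `g(x) = x log x − x`:
`𝔅(R) = ∫ q R dμ − ∫ u log R dμ`, valued in the extended reals.  It is realized as the
upper integral of the positive part of the integrand `q R − u log R` minus the upper
integral of its negative part; whenever `∫ u |log R| dμ < ∞` (and `R ≥ 0`) this agrees
with `∫ q R dμ − ∫ u log R dμ` as an element of `ℝ ∪ {+∞}`. -/
noncomputable def bregmanKLScore {d : ℕ} (q u R : (Fin d → ℝ) → ℝ) : EReal :=
  ((∫⁻ x, ENNReal.ofReal (q x * R x - u x * Real.log (R x)) ∂volume : ℝ≥0∞) : EReal)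
    - ((∫⁻ x, ENNReal.ofReal (u x * Real.log (R x) - q x * R x) ∂volume : ℝ≥0∞) : EReal)

theorem integrable_of_lintegral_ofReal_ne_top {α : Type*} [MeasurableSpace α] {μ : Measure α}
    {f : α → ℝ} (hf : AEStronglyMeasurable f μ) (h1 : ∫⁻ x, ENNReal.ofReal (f x) ∂μ ≠ ⊤)
    (h2 : ∫⁻ x, ENNReal.ofReal (-f x) ∂μ ≠ ⊤) : Integrable f μ := by
  refine ⟨hf, ?_⟩
  rw [hasFiniteIntegral_iff_norm]
  calc ∫⁻ x, ENNReal.ofReal ‖f x‖ ∂μ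
      ≤ ∫⁻ x, (ENNReal.ofReal (f x) + ENNReal.ofReal (-f x)) ∂μ := by
        refine lintegral_mono fun x => ?_
        rcases le_total 0 (f x) with h | h
        · simp [Real.norm_of_nonneg h]
        · simp [Real.norm_of_nonpos h]
    _ = ∫⁻ x, ENNReal.ofReal (f x) ∂μ + ∫⁻ x, ENNReal.ofReal (-f x) ∂μ :=
        lintegral_add_left' hf.aemeasurable.ennreal_ofReal _
    _ < ⊤ := ENNReal.add_lt_top.2 ⟨h1.lt_top, h2.lt_top⟩

theorem lintegral_ofReal_ne_top_of_ae_le {α : Type*} [MeasurableSpace α] {μ : Measure α}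
    {f g : α → ℝ} (hg : Integrable g μ) (h : f ≤ᵐ[μ] g) :
    ∫⁻ x, ENNReal.ofReal (f x) ∂μ ≠ ⊤ := by
  refine ne_top_of_le_ne_top hg.lintegral_lt_top.ne (lintegral_mono_ae ?_)
  filter_upwards [h] with x hx using ENNReal.ofReal_le_ofReal hx

theorem coe_lintegral_ofReal_sub_eq_integral {α : Type*} [MeasurableSpace α] {μ : Measure α}
    {f : α → ℝ} (hf : Integrable f μ) :
    ((∫⁻ x, ENNReal.ofReal (f x) ∂μ : ℝ≥0∞) : EReal)
      - ((∫⁻ x, ENNReal.ofReal (-f x) ∂μ : ℝ≥0∞) : EReal) = ((∫ x, f x ∂μ : ℝ) : EReal) := by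
  have h2 : ∫⁻ x, ENNReal.ofReal (-f x) ∂μ ≠ ⊤ := hf.neg.lintegral_lt_top.ne
  rw [integral_eq_lintegral_pos_part_sub_lintegral_neg_part hf, EReal.coe_sub,
    EReal.coe_ennreal_toReal hf.lintegral_lt_top.ne, EReal.coe_ennreal_toReal h2]

theorem bregmanKLScore_eq_lintegral_sub {d : ℕ} (q u R : (Fin d → ℝ) → ℝ) :
    bregmanKLScore q u R =
      ((∫⁻ x, ENNReal.ofReal (q x * R x - u x * Real.log (R x)) : ℝ≥0∞) : EReal)
        - ((∫⁻ x, ENNReal.ofReal (-(q x * R x - u x * Real.log (R x))) : ℝ≥0∞) : EReal) := by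
  simp only [neg_sub, bregmanKLScore]

theorem bregmanKLScore_mono {d : ℕ} {q u R S : (Fin d → ℝ) → ℝ}
    (h : ∀ᵐ x, q x * R x - u x * Real.log (R x) ≤ q x * S x - u x * Real.log (S x)) :
    bregmanKLScore q u R ≤ bregmanKLScore q u S := by
  refine EReal.sub_le_sub ?_ ?_ <;> rw [EReal.coe_ennreal_le_coe_ennreal_iff] <;>
    refine lintegral_mono_ae ?_ <;> filter_upwards [h] with x hx <;>
    exact ENNReal.ofReal_le_ofReal (by linarith)

theorem bregman_pointwise_lt {q u r : ℝ} (hq : 0 < q) (hu : 0 < u) (hr : 0 < r)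
    (hne : r ≠ u / q) :
    q * (u / q) - u * Real.log (u / q) < q * r - u * Real.log r := by
  have h1 : r / (u / q) ≠ 1 := fun h => hne ((div_eq_one_iff_eq (by positivity)).1 h)
  have h2 := Real.log_lt_sub_one_of_pos (by positivity) h1
  rw [Real.log_div hr.ne' (by positivity)] at h2
  have h3 := mul_lt_mul_of_pos_left h2 hu
  have h4 : u * (r / (u / q) - 1) = q * r - u := by field_simp
  have h5 : q * (u / q) = u := by field_simp
  linarith

theorem sub_le_mul_log_div {q u : ℝ} (hq : 0 < q) (hu : 0 < u) :
    u - q ≤ u * Real.log (u / q) := by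
  have h2 := mul_le_mul_of_nonneg_left (Real.one_sub_inv_le_log_of_pos (div_pos hu hq)) hu.le
  have h4 : u * (1 - (u / q)⁻¹) = u - q := by field_simp
  linarith

/-- With the generator `g(x) = x log x − x`, the Bregman score
`𝔅(R) = ∫ q R dμ − ∫ u log R dμ` of any measurable positive `R` with
`∫ u |log R| dμ < ∞` satisfies `𝔅(R) ≥ 𝔅(R*) = ∫ u dμ − ∫ u log (u/q) dμ`, where
`R* = u/q`, with equality iff `R = R*` a.e.  Here `q` is a probability density on
`ℝ^d` and `u` an unnormalized density (`0 < ∫ u < ∞`), both a.e. positive. -/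
theorem bregmanKLScore_ge_of_ratio
    (d : ℕ) (q u : (Fin d → ℝ) → ℝ)
    (hqm : Measurable q) (hum : Measurable u)
    (hq0 : ∀ x, 0 ≤ q x) (hq1 : ∫ x, q x ∂volume = 1)
    (hu0 : ∀ x, 0 ≤ u x)
    (huI : Integrable u volume) (huZ : 0 < ∫ x, u x ∂volume)
    (hqpos : ∀ᵐ x ∂(volume : Measure (Fin d → ℝ)), 0 < q x)
    (hupos : ∀ᵐ x ∂(volume : Measure (Fin d → ℝ)), 0 < u x)
    (R : (Fin d → ℝ) → ℝ) (hRm : Measurable R) (hRpos : ∀ x, 0 < R x)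
    (hRint : ∫⁻ x, ENNReal.ofReal (u x * |Real.log (R x)|) ∂volume < ⊤) :
    bregmanKLScore q u R ≥ bregmanKLScore q u (fun x => u x / q x) ∧
      bregmanKLScore q u (fun x => u x / q x)
        = ((∫ x, u x ∂volume : ℝ) : EReal)
          - (((∫⁻ x, ENNReal.ofReal (u x * Real.log (u x / q x)) ∂volume : ℝ≥0∞) : EReal)
            - ((∫⁻ x, ENNReal.ofReal (-(u x * Real.log (u x / q x))) ∂volume : ℝ≥0∞) :
              EReal)) ∧
      (bregmanKLScore q u R = bregmanKLScore q u (fun x => u x / q x) ↔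
        R =ᵐ[volume] fun x => u x / q x) := by
  have hqI : Integrable q volume := integrable_of_integral_eq_one hq1
  set S : (Fin d → ℝ) → ℝ := fun x => u x / q x with hS
  have hSm : Measurable S := hum.div hqm
  have hle : ∀ᵐ x, q x * S x - u x * Real.log (S x) ≤ q x * R x - u x * Real.log (R x) := by
    filter_upwards [hqpos, hupos] with x hq hu
    by_cases h : R x = S x
    · rw [h]
    · exact (bregman_pointwise_lt hq hu (hRpos x) h).le
  have hmono := bregmanKLScore_mono hle
  have hqS : ∀ᵐ x, q x * S x = u x := by
    filter_upwards [hqpos] with x hq using mul_div_cancel₀ _ hq.ne'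
  have hlog : ∀ᵐ x, u x - q x ≤ u x * Real.log (S x) := by
    filter_upwards [hqpos, hupos] with x hq hu using sub_le_mul_log_div hq hu
  have hlm : Measurable fun x => u x * Real.log (S x) := hum.mul hSm.log
  have hSposfin : ∫⁻ x, ENNReal.ofReal (q x * S x - u x * Real.log (S x)) ≠ ⊤ := by
    refine lintegral_ofReal_ne_top_of_ae_le hqI ?_
    filter_upwards [hqS, hlog] with x h1 h2
    linarith
  have hlnegfin : ∫⁻ x, ENNReal.ofReal (-(u x * Real.log (S x))) ≠ ⊤ := by
    refine lintegral_ofReal_ne_top_of_ae_le (hqI.sub huI) ?_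
    filter_upwards [hlog] with x h2
    simp only [Pi.sub_apply]
    linarith
  have hfS_iff : Integrable (fun x => q x * S x - u x * Real.log (S x)) volume ↔
      Integrable (fun x => u x * Real.log (S x)) volume := by
    have he : (fun x => q x * S x - u x * Real.log (S x))
        =ᵐ[volume] fun x => u x - u x * Real.log (S x) := by
      filter_upwards [hqS] with x h
      rw [h]
    rw [integrable_congr he]
    refine ⟨fun h => ?_, fun h => huI.sub h⟩
    exact (huI.sub h).congr (.of_forall fun x => sub_sub_cancel _ _)
  have hbot : ¬ Integrable (fun x => u x * Real.log (S x)) volume → bregmanKLScore q u S = ⊥ := by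
    intro hI
    have hneg : ∫⁻ x, ENNReal.ofReal (-(q x * S x - u x * Real.log (S x))) = ⊤ := by
      by_contra hne
      exact hI (hfS_iff.1 (integrable_of_lintegral_ofReal_ne_top
        ((hqm.mul hSm).sub hlm).aestronglyMeasurable hSposfin hne))
    rw [bregmanKLScore_eq_lintegral_sub, hneg, EReal.coe_ennreal_top, EReal.sub_top]
  refine ⟨hmono, ?_, fun heq => ?_, fun hRS => ?_⟩
  · by_cases hI : Integrable (fun x => u x * Real.log (S x)) volume
    · rw [bregmanKLScore_eq_lintegral_sub, coe_lintegral_ofReal_sub_eq_integral (hfS_iff.2 hI),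
        coe_lintegral_ofReal_sub_eq_integral hI, ← EReal.coe_sub, ← integral_sub huI hI]
      congr 1
      refine integral_congr_ae ?_
      filter_upwards [hqS] with x h
      rw [h]
    · have hpos : ∫⁻ x, ENNReal.ofReal (u x * Real.log (S x)) = ⊤ := by
        by_contra hne
        exact hI (integrable_of_lintegral_ofReal_ne_top hlm.aestronglyMeasurable hne hlnegfin)
      rw [hbot hI, hpos, ← EReal.coe_ennreal_toReal hlnegfin, EReal.coe_ennreal_top,
        EReal.top_sub_coe, EReal.sub_top]
  · have hRnegfin : ∫⁻ x, ENNReal.ofReal (-(q x * R x - u x * Real.log (R x))) ≠ ⊤ := by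
      refine ne_top_of_le_ne_top hRint.ne (lintegral_mono fun x => ENNReal.ofReal_le_ofReal ?_)
      have h1 := mul_nonneg (hq0 x) (hRpos x).le
      have h2 := mul_le_mul_of_nonneg_left (le_abs_self (Real.log (R x))) (hu0 x)
      linarith
    have hI : Integrable (fun x => u x * Real.log (S x)) volume := by
      by_contra hI
      rw [hbot hI, bregmanKLScore_eq_lintegral_sub, ← EReal.coe_ennreal_toReal hRnegfin,
        sub_eq_add_neg, EReal.add_eq_bot_iff] at heq
      rcases heq with h | h
      · exact EReal.coe_ennreal_ne_bot _ h
      · rw [← EReal.coe_neg] at h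
        exact EReal.coe_ne_bot _ h
    have hfS := hfS_iff.2 hI
    have hfR : Integrable (fun x => q x * R x - u x * Real.log (R x)) volume := by
      refine integrable_of_lintegral_ofReal_ne_top
        ((hqm.mul hRm).sub (hum.mul hRm.log)).aestronglyMeasurable (fun htop => ?_) hRnegfin
      rw [bregmanKLScore_eq_lintegral_sub, bregmanKLScore_eq_lintegral_sub q u S,
        coe_lintegral_ofReal_sub_eq_integral hfS, htop, ← EReal.coe_ennreal_toReal hRnegfin,
        EReal.coe_ennreal_top, EReal.top_sub_coe] at heq
      exact EReal.coe_ne_top _ heq.symm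
    rw [bregmanKLScore_eq_lintegral_sub, bregmanKLScore_eq_lintegral_sub q u S,
      coe_lintegral_ofReal_sub_eq_integral hfS, coe_lintegral_ofReal_sub_eq_integral hfR,
      EReal.coe_eq_coe_iff] at heq
    have hae := (integral_eq_iff_of_ae_le hfS hfR hle).1 heq.symm
    filter_upwards [hae, hqpos, hupos] with x hx hq hu
    by_contra hne
    exact (bregman_pointwise_lt hq hu (hRpos x) hne).ne hx
  · refine le_antisymm (bregmanKLScore_mono ?_) hmono
    filter_upwards [hRS] with x hx
    rw [hx]
end
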